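/- arXiv:1408.0943 — 3 statements merged into one kernel-verified Lean document; each statement's English description precedes it below -/
import Mathlib

section
/- For every MultiAspect Graph (MAG) H of order p > 0 in which every aspect is a nonempty finite set, there exists a directed graph G with ∏_{n=1}^{p} τ_n vertices (where τ_n = |A(H)[n]|) that is isomorphic to H, and G is unique up to directed-graph isomorphism: if G and J are directed graphs each isomorphic to H via bijections f : 𝕍(H) → V(G) and j : 𝕍(H) → V(J), then the composite j ∘ f⁻¹ : V(G) → V(J) is a directed-graph isomorphism between G and J. -/
/-- A MultiAspect Graph (MAG): an order `p > 0`, a list of `p` nonempty finite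
aspects `A 0, …, A (p-1)`, and a set `E` of edges.  Via the canonical bijection
`ψ : 𝔼(H) → 𝕍(H) × 𝕍(H)`, an edge is given by its pair of origin/destination
composite vertices; self-loops are forbidden. -/
structure MAG where
  p : ℕ
  p_pos : 0 < p
  A : Fin p → Type
  fintypeA : ∀ i, Fintype (A i)
  nonemptyA : ∀ i, Nonempty (A i)
  E : Set ((∀ i, A i) × (∀ i, A i))
  no_self_loops : ∀ e ∈ E, e.1 ≠ e.2

namespace MAG

/-- The set of composite vertices `𝕍(H)`. -/
abbrev CV (H : MAG) : Type := ∀ i, H.A i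

/-- The origin composite vertex `π_o(e)` of an edge. -/
def πo (H : MAG) (e : H.CV × H.CV) : H.CV := e.1

/-- The destination composite vertex `π_d(e)` of an edge. -/
def πd (H : MAG) (e : H.CV × H.CV) : H.CV := e.2

/-- The set of composite vertices is nonempty. -/
def cvNonempty (H : MAG) : Nonempty H.CV := ⟨fun i => (H.nonemptyA i).some⟩

end MAG

/-- A directed graph: a vertex type together with a set of directed edges. -/
structure Digraph' where
  V : Type
  E : Set (V × V)

/-- The composite vertices representation `g(H)` of a MAG `H`: the directed graph
with vertex set `𝕍(H)` and edge set `{(π_o(e), π_d(e)) : e ∈ E(H)}`. -/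
def MAG.g (H : MAG) : Digraph' :=
  ⟨H.CV, (fun e => (H.πo e, H.πd e)) '' H.E⟩

/-- A directed graph `G` is isomorphic to the MAG `H` via `f : 𝕍(H) → V(G)` if `f`
is a bijection and `e ∈ E(H) ↔ (f (π_o e), f (π_d e)) ∈ E(G)`. -/
def MAGDigraphIso (H : MAG) (G : Digraph') (f : H.CV → G.V) : Prop :=
  Function.Bijective f ∧ ∀ e : H.CV × H.CV, (e ∈ H.E ↔ (f (H.πo e), f (H.πd e)) ∈ G.E)

/-- A walk on an edge set, recorded by its (nonempty) sequence of vertices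
`[u_1, …, u_k]`; the edge `e_n` of the walk is `(u_n, u_{n+1}) ∈ E`. -/
def WalkOn {α : Type} (E : Set (α × α)) (vs : List α) : Prop :=
  vs ≠ [] ∧ vs.Chain' (fun u v => (u, v) ∈ E)

/-- The sequence of edges `[e_1, …, e_{k-1}]`, `e_n = (u_n, u_{n+1})`, of a walk. -/
def walkEdges {α : Type} (vs : List α) : List (α × α) := vs.zip vs.tail

/-- The length `Len(W)` of a walk: its number of edges. -/
def walkLen {α : Type} (vs : List α) : ℕ := (walkEdges vs).length

/-- A trail: a walk all of whose edges are distinct. -/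
def TrailOn {α : Type} (E : Set (α × α)) (vs : List α) : Prop :=
  WalkOn E vs ∧ (walkEdges vs).Nodup

/-- A path: a walk all of whose vertices are distinct. -/
def PathOn {α : Type} (E : Set (α × α)) (vs : List α) : Prop :=
  WalkOn E vs ∧ vs.Nodup

/-- A cycle: a closed path, i.e. a walk with at least one edge whose first and last
vertices coincide and whose vertices are otherwise all distinct. -/
def CycleOn {α : Type} (E : Set (α × α)) (vs : List α) : Prop :=
  WalkOn E vs ∧ 2 ≤ vs.length ∧ vs.head? = vs.getLast? ∧ vs.dropLast.Nodup

/-- A shortest path from `u` to `v`: a path from `u` to `v` of minimal length. -/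
def IsShortestPathOn {α : Type} (E : Set (α × α)) (u v : α) (vs : List α) : Prop :=
  PathOn E vs ∧ vs.head? = some u ∧ vs.getLast? = some v ∧
    ∀ ws, PathOn E ws → ws.head? = some u → ws.getLast? = some v → walkLen vs ≤ walkLen ws

/-- The girth: the length of a shortest cycle (`⊤` if there is no cycle). -/
noncomputable def girthOf {α : Type} (E : Set (α × α)) : ℕ∞ :=
  sInf ((fun vs => (walkLen vs : ℕ∞)) '' {vs | CycleOn E vs})

namespace MAG

/-- A sub-determination `ζ`: a nonempty proper sublist of the aspects of `H`. -/
def IsSubDet (H : MAG) (ζ : Set (Fin H.p)) : Prop := ζ.Nonempty ∧ ζ ≠ Set.univ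

/-- The sub-determined composite vertices `𝕍_ζ(H)`. -/
def subCV (H : MAG) (ζ : Set (Fin H.p)) : Type := ∀ i : {j : Fin H.p // j ∈ ζ}, H.A i.val

/-- `S_ζ`: sub-determination of a composite vertex. -/
def S (H : MAG) (ζ : Set (Fin H.p)) (u : H.CV) : H.subCV ζ := fun i => u i.val

/-- `E_ζ`: sub-determination of an edge. -/
def Esub (H : MAG) (ζ : Set (Fin H.p)) (e : H.CV × H.CV) : H.subCV ζ × H.subCV ζ :=
  (H.S ζ e.1, H.S ζ e.2)

/-- The edge set of the sub-determined MAG `M_ζ(H)`: the non-self-loop images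
`E_ζ(e)` for `e ∈ E(H)`. -/
def subE (H : MAG) (ζ : Set (Fin H.p)) : Set (H.subCV ζ × H.subCV ζ) :=
  {s | (∃ e ∈ H.E, s = H.Esub ζ e) ∧ s.1 ≠ s.2}

/-- The distance between composite vertices: the length of a shortest walk
(equivalently, shortest path) from `u` to `v`, `⊤` if no such walk exists. -/
noncomputable def dist (H : MAG) (u v : H.CV) : ℕ∞ :=
  sInf ((fun vs => (walkLen vs : ℕ∞)) ''
    {vs | WalkOn H.E vs ∧ vs.head? = some u ∧ vs.getLast? = some v})

end MAG

/-- The identity map is an isomorphism from a MAG to its composite vertices representation. -/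
theorem MAG.iso_g (H : MAG) : MAGDigraphIso H H.g (id : H.CV → H.CV) := by
  refine ⟨Function.bijective_id, fun e => ⟨fun he => ⟨e, he, rfl⟩, ?_⟩⟩
  rintro ⟨e', he', h⟩
  have : e' = e := h
  exact this ▸ he'

/-- The number of composite vertices is the product of the sizes of the aspects. -/
theorem MAG.card_CV (H : MAG) : Nat.card H.CV = ∏ i, Nat.card (H.A i) :=
  Nat.card_pi

/-- For every MAG `H` (order `p > 0`, all aspects nonempty finite)
there is a directed graph `G` with `∏ τ_n` vertices isomorphic to `H`; and `G` is
unique up to directed-graph isomorphism: if `G`, `J` are isomorphic to `H` via `f`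
and `j`, then `j ∘ f⁻¹` is a directed-graph isomorphism from `G` to `J`. -/
theorem stmt0 (H : MAG) :
    (∃ (G : Digraph') (f : H.CV → G.V),
        MAGDigraphIso H G f ∧ Nat.card G.V = ∏ i, Nat.card (H.A i)) ∧
    (∀ (G J : Digraph') (f : H.CV → G.V) (j : H.CV → J.V),
        MAGDigraphIso H G f → MAGDigraphIso H J j →
        Function.Bijective (j ∘ @Function.invFun H.CV G.V H.cvNonempty f) ∧
          ∀ u v : G.V, (u, v) ∈ G.E ↔
            ((j ∘ @Function.invFun H.CV G.V H.cvNonempty f) u,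
              (j ∘ @Function.invFun H.CV G.V H.cvNonempty f) v) ∈ J.E) := by
  refine ⟨⟨H.g, id, H.iso_g, H.card_CV⟩, ?_⟩
  rintro G J f j ⟨hf, hfE⟩ ⟨hj, hjE⟩
  have : Nonempty H.CV := H.cvNonempty
  have hr : Function.RightInverse (Function.invFun f) f := Function.rightInverse_invFun hf.2
  have hl : Function.LeftInverse (Function.invFun f) f := Function.leftInverse_invFun hf.1
  refine ⟨hj.comp ⟨hr.injective, hl.surjective⟩, fun u v => ?_⟩
  have h := (hfE (Function.invFun f u, Function.invFun f v)).symm.trans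
    (hjE (Function.invFun f u, Function.invFun f v))
  simpa only [Function.comp_apply, MAG.πo, MAG.πd, hr u, hr v] using h
end

section
/- Let H be a MAG, ζ a sub-determination of H, and W = [u_1, e_1, u_2, …, u_{k-1}, e_{k-1}, u_k] a walk on H. Then the projection of W onto M_ζ(H) — the alternating sequence obtained from [S_ζ(u_1), E_ζ(e_1), S_ζ(u_2), …, E_ζ(e_{k-1}), S_ζ(u_k)] by deleting every sub-determined edge E_ζ(e_n) that is a self-loop together with the duplicate composite vertex it creates — is a walk on the sub-determined MAG M_ζ(H) from S_ζ(u_1) to S_ζ(u_k) (possibly reduced to the single composite vertex S_ζ(u_1) and no edges). -/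
namespace List

variable {α β : Type*} [DecidableEq β]

theorem head?_destutter'_ne (l : List β) (b : β) :
    (l.destutter' (· ≠ ·) b).head? = some b := by
  induction l with
  | nil => rfl
  | cons c l ih =>
    by_cases h : b = c
    · simpa [destutter', h] using h ▸ ih
    · simp [destutter', h]

theorem getLast?_destutter'_ne (l : List β) (b : β) :
    (l.destutter' (· ≠ ·) b).getLast? = (b :: l).getLast? := by
  induction l generalizing b with
  | nil => rfl
  | cons c l ih =>
    by_cases h : b = c
    · subst h
      rw [destutter'_cons_neg _ (by simp), ih, getLast?_cons_cons]
    · rw [destutter'_cons_pos _ h, getLast?_cons, ih c, getLast?_cons_cons]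
      simp [getLast?_cons]

/-- Collapsing repetitions in the image of an `R`-chain leaves consecutive entries that are
distinct images of `R`-related elements. -/
theorem IsChain.destutter'_map_ne {R : α → α → Prop} (f : α → β) {l : List α} {a : α}
    (h : (a :: l).IsChain R) :
    ((l.map f).destutter' (· ≠ ·) (f a)).IsChain
      fun x y => (∃ u v, R u v ∧ x = f u ∧ y = f v) ∧ x ≠ y := by
  induction l generalizing a with
  | nil => simp
  | cons c l ih =>
    obtain ⟨hac, hl⟩ := isChain_cons_cons.1 h
    by_cases hf : f a = f c
    · rw [map_cons, destutter'_cons_neg _ (by simpa using hf), hf]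
      exact ih hl
    · rw [map_cons, destutter'_cons_pos _ hf]
      refine (ih hl).cons fun y hy => ?_
      rw [head?_destutter'_ne, Option.mem_some_iff] at hy
      subst hy
      exact ⟨⟨a, c, hac, rfl, rfl⟩, hf⟩

end List

/-- Let `ζ` be a sub-determination of a MAG `H` and `W` a walk on
`H` with vertex sequence `vs = [u_1, …, u_k]`.  The projection of `W` onto `M_ζ(H)`
— obtained from `[S_ζ u_1, …, S_ζ u_k]` by deleting the self-loop sub-determined
edges together with the duplicate composite vertices they create (i.e. collapsing
consecutive repetitions) — is a walk on `M_ζ(H)` from `S_ζ u_1` to `S_ζ u_k`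
(possibly reduced to the single composite vertex `S_ζ u_1` and no edges). -/
theorem stmt8 (H : MAG) (ζ : Set (Fin H.p)) [DecidableEq (H.subCV ζ)]
    (hζ : H.IsSubDet ζ) (vs : List H.CV) (hvs : WalkOn H.E vs) :
    WalkOn (H.subE ζ) ((vs.map (H.S ζ)).destutter (· ≠ ·)) ∧
    ((vs.map (H.S ζ)).destutter (· ≠ ·)).head? = vs.head?.map (H.S ζ) ∧
    ((vs.map (H.S ζ)).destutter (· ≠ ·)).getLast? = vs.getLast?.map (H.S ζ) := by
  obtain ⟨hne, hchain⟩ := hvs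
  obtain ⟨u, l, rfl⟩ := List.exists_cons_of_ne_nil hne
  rw [List.map_cons, List.destutter_cons']
  refine ⟨⟨List.destutter'_ne_nil _ _, ?_⟩, ?_, ?_⟩
  · refine (List.IsChain.destutter'_map_ne (H.S ζ) hchain).imp ?_
    rintro x y ⟨⟨v, w, hvw, rfl, rfl⟩, hxy⟩
    exact ⟨⟨(v, w), hvw, rfl⟩, hxy⟩
  · rw [List.head?_destutter'_ne, List.head?_cons, Option.map_some]
  · rw [List.getLast?_destutter'_ne, ← List.map_cons, List.getLast?_map]
end

section
/- There exist a MAG H, a sub-determination ζ of H, and a trail W = [u_1, e_1, u_2, e_2, u_3, e_3, u_4, e_4, u_5] on H whose five composite vertices are all distinct, such that S_ζ(u_1) = S_ζ(u_4) and S_ζ(u_2) = S_ζ(u_5), whence E_ζ(e_1) = E_ζ(e_4); consequently the projection of the trail W onto M_ζ(H) has a repeated edge and is therefore not a trail on M_ζ(H). Hence the projection of a trail onto a sub-determined MAG is not necessarily a trail. -/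
/-- The MAG with two aspects `Fin 3` whose edges are the pairs of composite vertices that differ
in the first aspect. -/
abbrev firstAspectMAG : MAG where
  p := 2
  p_pos := Nat.zero_lt_two
  A := fun _ => Fin 3
  fintypeA := fun _ => inferInstance
  nonemptyA := fun _ => inferInstance
  E := {e | e.1 0 ≠ e.2 0}
  no_self_loops := fun _ he h => he (congrFun h 0)

theorem firstAspectMAG_esub_mem_subE {u v : firstAspectMAG.CV} (h : u 0 ≠ v 0) :
    (firstAspectMAG.S {0} u, firstAspectMAG.S {0} v) ∈ firstAspectMAG.subE {0} :=
  ⟨⟨(u, v), h, rfl⟩, fun heq => h (congrFun heq ⟨0, rfl⟩)⟩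

theorem firstAspectMAG_S_eq {u v : firstAspectMAG.CV} (h : u 0 = v 0) :
    firstAspectMAG.S {0} u = firstAspectMAG.S {0} v := by
  funext ⟨i, hi⟩
  obtain rfl : i = 0 := hi
  exact h

theorem not_trailOn_of_repeated_edge {α : Type} {E : Set (α × α)} (a b c : α) :
    ¬ TrailOn E [a, b, c, a, b] := by
  rintro ⟨-, h⟩
  simp [walkEdges] at h

/-- There exist a MAG `H`, a sub-determination `ζ`, and a trail
`W = [u_1, e_1, u_2, e_2, u_3, e_3, u_4, e_4, u_5]` on `H` with all five composite
vertices distinct, `S_ζ u_1 = S_ζ u_4` and `S_ζ u_2 = S_ζ u_5`, whence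
`E_ζ e_1 = E_ζ e_4`; the projection of `W` onto `M_ζ(H)` is a walk with a repeated
edge, hence not a trail on `M_ζ(H)`. -/
theorem stmt10 :
    ∃ (H : MAG) (ζ : Set (Fin H.p)), H.IsSubDet ζ ∧
      ∃ u₁ u₂ u₃ u₄ u₅ : H.CV,
        TrailOn H.E [u₁, u₂, u₃, u₄, u₅] ∧
        ([u₁, u₂, u₃, u₄, u₅] : List H.CV).Nodup ∧
        H.S ζ u₁ = H.S ζ u₄ ∧ H.S ζ u₂ = H.S ζ u₅ ∧
        H.Esub ζ (u₁, u₂) = H.Esub ζ (u₄, u₅) ∧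
        WalkOn (H.subE ζ) ([u₁, u₂, u₃, u₄, u₅].map (H.S ζ)) ∧
        ¬ TrailOn (H.subE ζ) ([u₁, u₂, u₃, u₄, u₅].map (H.S ζ)) := by
  have h14 := firstAspectMAG_S_eq (u := ![0, 0]) (v := ![0, 1]) rfl
  have h25 := firstAspectMAG_S_eq (u := ![1, 0]) (v := ![1, 1]) rfl
  refine ⟨firstAspectMAG, {0}, ⟨⟨0, rfl⟩, ?_⟩, ![0, 0], ![1, 0], ![2, 0], ![0, 1], ![1, 1],
    ⟨⟨by simp, ?_⟩, ?_⟩, ?_, h14, h25, Prod.ext h14 h25, ⟨by simp, ?_⟩, ?_⟩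
  · intro h
    have h1 : (1 : Fin 2) ∈ ({0} : Set (Fin 2)) := h ▸ Set.mem_univ _
    simp at h1
  · simp [List.Chain']
  · change (walkEdges (α := Fin 2 → Fin 3) _).Nodup
    decide
  · change List.Nodup (α := Fin 2 → Fin 3) _
    decide
  · refine .cons_cons (firstAspectMAG_esub_mem_subE ?_) <|
      .cons_cons (firstAspectMAG_esub_mem_subE ?_) <|
      .cons_cons (firstAspectMAG_esub_mem_subE ?_) <|
      .cons_cons (firstAspectMAG_esub_mem_subE ?_) <| .singleton _
    all_goals simp
  · simp only [List.map_cons, List.map_nil, ← h14, ← h25]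
    exact not_trailOn_of_repeated_edge _ _ _
end
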